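/- arXiv:0803.2392 — 2 statements merged into one kernel-verified Lean document; each statement's English description precedes it below -/
import Mathlib

section
/- Let Φ be an m×N complex matrix with δ_{2s}(Φ) ≤ δ_{4s}(Φ) ≤ 0.1. Let x ∈ ℂ^N be s-sparse, let a ∈ ℂ^N be s-sparse, set r = x − a, let e ∈ ℂ^m, let v = Φr + e, and let y = Φ*v. Let Ω be a set of 2s coordinates on which y has its 2s largest magnitudes (i.e., Ω = supp(y_{2s})). Then ‖r|_{Ω^c}‖₂ ≤ 0.2223·‖r‖₂ + 2.34·‖e‖₂. -/
open Matrix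
open scoped BigOperators Classical

/-- The Euclidean (ℓ₂) norm of a finitely indexed complex vector. -/
noncomputable def l2 {ι : Type*} [Fintype ι] (x : ι → ℂ) : ℝ :=
  Real.sqrt (∑ i, ‖x i‖ ^ 2)

/-- The ℓ₁ norm of a finitely indexed complex vector. -/
noncomputable def l1 {ι : Type*} [Fintype ι] (x : ι → ℂ) : ℝ := ∑ i, ‖x i‖

/-- The ℓ∞ (supremum) norm of a finitely indexed complex vector. -/
noncomputable def linf {ι : Type*} [Fintype ι] (x : ι → ℂ) : ℝ := ⨆ i, ‖x i‖

/-- The support of a vector, as a finite set of coordinates. -/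
noncomputable def suppF {N : ℕ} (x : Fin N → ℂ) : Finset (Fin N) :=
  Finset.univ.filter fun i => x i ≠ 0

/-- A vector is `s`-sparse when it has at most `s` nonzero entries. -/
def Sparse {N : ℕ} (s : ℕ) (x : Fin N → ℂ) : Prop := (suppF x).card ≤ s

/-- Restriction of a vector to a set `T` of coordinates: equal to `x` on `T`, zero off `T`. -/
noncomputable def restrictTo {N : ℕ} (x : Fin N → ℂ) (T : Finset (Fin N)) : Fin N → ℂ :=
  fun i => if i ∈ T then x i else 0

/-- `y` is a best `s`-sparse approximation of `x`: it agrees with `x` on a set of `s`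
coordinates of largest magnitude and vanishes elsewhere. -/
def IsSparseApprox {N : ℕ} (s : ℕ) (x y : Fin N → ℂ) : Prop :=
  ∃ T : Finset (Fin N), T.card = min s N ∧ y = restrictTo x T ∧
    ∀ i ∈ T, ∀ j ∉ T, ‖x j‖ ≤ ‖x i‖

/-- The `r`-th restricted isometry constant of `Φ`: the least `δ ≥ 0` such that
`(1-δ)‖x‖² ≤ ‖Φx‖² ≤ (1+δ)‖x‖²` for all `r`-sparse `x`. -/
noncomputable def RIC {m N : ℕ} (Φ : Matrix (Fin m) (Fin N) ℂ) (r : ℕ) : ℝ :=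
  sInf {δ : ℝ | 0 ≤ δ ∧ ∀ x : Fin N → ℂ, Sparse r x →
    (1 - δ) * l2 x ^ 2 ≤ l2 (Φ.mulVec x) ^ 2 ∧ l2 (Φ.mulVec x) ^ 2 ≤ (1 + δ) * l2 x ^ 2}

/-- The column submatrix of `Φ` with columns indexed by the finite set `T`. -/
noncomputable def colSub {m N : ℕ} (Φ : Matrix (Fin m) (Fin N) ℂ) (T : Finset (Fin N)) :
    Matrix (Fin m) {i // i ∈ T} ℂ :=
  Matrix.of fun r c => Φ r c.1

/-- The least-squares estimate `Φ_T† u = (Φ_T* Φ_T)⁻¹ Φ_T* u`, viewed as a vector in `ℂ^N`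
supported on `T`. -/
noncomputable def pinvApply {m N : ℕ} (Φ : Matrix (Fin m) (Fin N) ℂ) (T : Finset (Fin N))
    (u : Fin m → ℂ) : Fin N → ℂ :=
  fun j =>
    if h : j ∈ T then (((colSub Φ T)ᴴ * colSub Φ T)⁻¹ * (colSub Φ T)ᴴ).mulVec u ⟨j, h⟩
    else 0

/-- One iteration of CoSaMP with samples `u` and sparsity level `s`, mapping the current
approximation `a` to the next approximation `a'`. -/
def CoSaMPStep {m N : ℕ} (Φ : Matrix (Fin m) (Fin N) ℂ) (u : Fin m → ℂ) (s : ℕ)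
    (a a' : Fin N → ℂ) : Prop :=
  ∃ y2s : Fin N → ℂ,
    IsSparseApprox (2 * s) (Φᴴ.mulVec (u - Φ.mulVec a)) y2s ∧
    IsSparseApprox s (pinvApply Φ (suppF y2s ∪ suppF a) u) a'

/-- `a` is a sequence of approximations produced by CoSaMP: `a 0 = 0` and each successive
approximation arises from one CoSaMP iteration. -/
def CoSaMPSeq {m N : ℕ} (Φ : Matrix (Fin m) (Fin N) ℂ) (u : Fin m → ℂ) (s : ℕ)
    (a : ℕ → Fin N → ℂ) : Prop :=
  a 0 = 0 ∧ ∀ k, CoSaMPStep Φ u s (a k) (a (k + 1))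

/-- The spectral norm (ℓ₂ → ℓ₂ operator norm) of a matrix. -/
noncomputable def specNorm {a b : Type*} [Fintype a] [Fintype b] (M : Matrix a b ℂ) : ℝ :=
  sSup ((fun x => l2 (M.mulVec x)) '' {x | l2 x ≤ 1})

/-- The real part of the standard Hermitian inner product. -/
noncomputable def reInner {ι : Type*} [Fintype ι] (u w : ι → ℂ) : ℝ := (star u ⬝ᵥ w).re

section VectorLemmas

variable {ι : Type*} [Fintype ι]

lemma l2_eq_norm_toLp (u : ι → ℂ) : l2 u = ‖WithLp.toLp 2 u‖ := by
  simp [l2, EuclideanSpace.norm_eq]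

lemma l2_nonneg (u : ι → ℂ) : 0 ≤ l2 u := Real.sqrt_nonneg _

lemma l2_sq (u : ι → ℂ) : l2 u ^ 2 = ∑ i, ‖u i‖ ^ 2 :=
  Real.sq_sqrt (Finset.sum_nonneg fun _ _ => sq_nonneg _)

lemma l2_eq_zero {u : ι → ℂ} (h : l2 u = 0) : u = 0 := by
  rw [l2_eq_norm_toLp, norm_eq_zero] at h
  exact congrArg WithLp.ofLp h

lemma reInner_eq_re_inner (u w : ι → ℂ) :
    reInner u w = (inner ℂ (WithLp.toLp 2 u) (WithLp.toLp 2 w)).re := by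
  rw [EuclideanSpace.inner_toLp_toLp, dotProduct_comm, reInner]

lemma reInner_self (u : ι → ℂ) : reInner u u = l2 u ^ 2 := by
  rw [reInner_eq_re_inner, l2_eq_norm_toLp]
  exact inner_self_eq_norm_sq (𝕜 := ℂ) _

lemma abs_reInner_le (u w : ι → ℂ) : |reInner u w| ≤ l2 u * l2 w := by
  rw [reInner_eq_re_inner, l2_eq_norm_toLp, l2_eq_norm_toLp]
  exact (Complex.abs_re_le_norm _).trans (norm_inner_le_norm _ _)

lemma reInner_add_right (u v w : ι → ℂ) : reInner u (v + w) = reInner u v + reInner u w := by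
  simp [reInner]

lemma reInner_smul_smul (b c : ℝ) (u w : ι → ℂ) :
    reInner ((b : ℂ) • u) ((c : ℂ) • w) = b * c * reInner u w := by
  simp [reInner, star_smul, mul_assoc, mul_left_comm]

lemma l2_smul (c : ℝ) (u : ι → ℂ) : l2 ((c : ℂ) • u) = |c| * l2 u := by
  rw [l2_eq_norm_toLp, l2_eq_norm_toLp, WithLp.toLp_smul, norm_smul]
  simp

lemma l2_add_sq (u w : ι → ℂ) : l2 (u + w) ^ 2 = l2 u ^ 2 + 2 * reInner u w + l2 w ^ 2 := by
  rw [reInner_eq_re_inner, l2_eq_norm_toLp, l2_eq_norm_toLp, l2_eq_norm_toLp, WithLp.toLp_add]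
  exact norm_add_sq (𝕜 := ℂ) _ _

lemma l2_sub_sq (u w : ι → ℂ) : l2 (u - w) ^ 2 = l2 u ^ 2 - 2 * reInner u w + l2 w ^ 2 := by
  rw [reInner_eq_re_inner, l2_eq_norm_toLp, l2_eq_norm_toLp, l2_eq_norm_toLp, WithLp.toLp_sub]
  exact norm_sub_sq (𝕜 := ℂ) _ _

lemma reInner_conjTranspose_mulVec {κ : Type*} [Fintype κ] (Φ : Matrix κ ι ℂ) (u : ι → ℂ)
    (v : κ → ℂ) : reInner u (Φᴴ.mulVec v) = reInner (Φ.mulVec u) v := by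
  rw [reInner, reInner, dotProduct_mulVec, star_mulVec]

end VectorLemmas

section Restriction

variable {N : ℕ}

lemma sparse_of_subset {x : Fin N → ℂ} {r : ℕ} {S : Finset (Fin N)} (hS : S.card ≤ r)
    (h : ∀ i ∉ S, x i = 0) : Sparse r x := by
  refine (Finset.card_le_card fun i hi => ?_).trans hS
  by_contra hiS
  simp [suppF, h i hiS] at hi

lemma eq_zero_of_notMem_suppF {x : Fin N → ℂ} {i : Fin N} (h : i ∉ suppF x) : x i = 0 := by
  simpa [suppF] using h

lemma restrictTo_of_notMem (x : Fin N → ℂ) {T : Finset (Fin N)} {i : Fin N} (h : i ∉ T) :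
    restrictTo x T i = 0 := if_neg h

lemma l2_restrictTo_sq (x : Fin N → ℂ) (T : Finset (Fin N)) :
    l2 (restrictTo x T) ^ 2 = ∑ i ∈ T, ‖x i‖ ^ 2 := by
  rw [l2_sq, ← Finset.sum_filter_add_sum_filter_not Finset.univ (· ∈ T)]
  rw [Finset.sum_congr rfl (g := fun i => ‖x i‖ ^ 2)
    (fun i hi => by simp [restrictTo, (Finset.mem_filter.1 hi).2])]
  rw [Finset.sum_eq_zero (s := Finset.univ.filter fun i => i ∉ T)
    (fun i hi => by simp [restrictTo, (Finset.mem_filter.1 hi).2])]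
  simp

lemma reInner_restrictTo_restrictTo (u w : Fin N → ℂ) (T : Finset (Fin N)) :
    reInner (restrictTo u T) (restrictTo w T) = reInner (restrictTo u T) w := by
  unfold reInner dotProduct
  congr 1
  refine Finset.sum_congr rfl fun i _ => ?_
  by_cases h : i ∈ T <;> simp [restrictTo, h]

/-- A sum over at most as many, pairwise smaller, nonnegative terms is smaller. -/
lemma sum_le_sum_of_card_le_of_le {ι : Type*} {A B : Finset ι} {f : ι → ℝ}
    (hf : ∀ i, 0 ≤ f i) (hcard : A.card ≤ B.card) (h : ∀ i ∈ A, ∀ j ∈ B, f i ≤ f j) :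
    ∑ i ∈ A, f i ≤ ∑ j ∈ B, f j := by
  rcases A.eq_empty_or_nonempty with rfl | hA
  · simpa using Finset.sum_nonneg fun i _ => hf i
  · obtain ⟨k, hk, hmax⟩ := A.exists_max_image f hA
    calc ∑ i ∈ A, f i ≤ A.card • f k := Finset.sum_le_card_nsmul _ _ _ hmax
      _ ≤ B.card • f k := nsmul_le_nsmul_left (hf k) hcard
      _ ≤ ∑ j ∈ B, f j := Finset.card_nsmul_le_sum _ _ _ fun j hj => h k hk j hj

end Restriction

section RestrictedIsometry

variable {m N : ℕ} {Φ : Matrix (Fin m) (Fin N) ℂ} {r : ℕ} {δ : ℝ}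

lemma exists_l2_mulVec_le (Φ : Matrix (Fin m) (Fin N) ℂ) :
    ∃ C : ℝ, ∀ x, l2 (Φ.mulVec x) ≤ C * l2 x := by
  refine ⟨‖(Matrix.toEuclideanLin Φ).toContinuousLinearMap‖, fun x => ?_⟩
  rw [l2_eq_norm_toLp, l2_eq_norm_toLp]
  exact (Matrix.toEuclideanLin Φ).toContinuousLinearMap.le_opNorm (WithLp.toLp 2 x)

/-- The infimum defining the restricted isometry constant is taken over a nonempty set and is
attained. -/
lemma abs_l2_mulVec_sq_sub_le_of_RIC_le (h : RIC Φ r ≤ δ) {x : Fin N → ℂ} (hx : Sparse r x) :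
    |l2 (Φ.mulVec x) ^ 2 - l2 x ^ 2| ≤ δ * l2 x ^ 2 := by
  obtain ⟨C, hC⟩ := exists_l2_mulVec_le Φ
  rcases (l2_nonneg x).eq_or_lt with h0 | h0
  · obtain rfl := l2_eq_zero h0.symm
    simp [l2]
  · rw [← div_le_iff₀ (by positivity)]
    refine le_trans (le_csInf ?_ ?_) h
    · refine ⟨1 + C ^ 2, by positivity, fun z _ => ⟨?_, ?_⟩⟩
      · nlinarith [sq_nonneg (l2 (Φ.mulVec z)), mul_nonneg (sq_nonneg C) (sq_nonneg (l2 z))]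
      · nlinarith [pow_le_pow_left₀ (l2_nonneg (Φ.mulVec z)) (hC z) 2, sq_nonneg (l2 z)]
    · rintro d ⟨-, hd⟩
      rw [div_le_iff₀ (by positivity), abs_le]
      obtain ⟨h1, h2⟩ := hd x hx
      constructor <;> linarith

/-- The form `⟨Φu, Φw⟩` is within `δ‖u‖‖w‖` of `⟨u, w⟩` for vectors with small joint support. -/
lemma reInner_mulVec_sub_le (h : RIC Φ r ≤ δ) {u w : Fin N → ℂ} {S : Finset (Fin N)}
    (hS : S.card ≤ r) (hu : ∀ i ∉ S, u i = 0) (hw : ∀ i ∉ S, w i = 0) :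
    |reInner (Φ.mulVec u) (Φ.mulVec w) - reInner u w| ≤ δ * (l2 u * l2 w) := by
  rcases (l2_nonneg u).eq_or_lt with h0 | hu0
  · obtain rfl := l2_eq_zero h0.symm
    simp [reInner, l2]
  rcases (l2_nonneg w).eq_or_lt with h0 | hw0
  · obtain rfl := l2_eq_zero h0.symm
    simp [reInner, l2]
  set b := l2 u with hb
  set c := l2 w with hc
  have hp := abs_l2_mulVec_sq_sub_le_of_RIC_le h (x := (c : ℂ) • u + (b : ℂ) • w)
    (sparse_of_subset hS fun i hi => by simp [hu i hi, hw i hi])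
  have hm := abs_l2_mulVec_sq_sub_le_of_RIC_le h (x := (c : ℂ) • u - (b : ℂ) • w)
    (sparse_of_subset hS fun i hi => by simp [hu i hi, hw i hi])
  rw [mulVec_add, mulVec_smul, mulVec_smul, l2_add_sq, l2_add_sq, reInner_smul_smul,
    reInner_smul_smul] at hp
  rw [mulVec_sub, mulVec_smul, mulVec_smul, l2_sub_sq, l2_sub_sq, reInner_smul_smul,
    reInner_smul_smul] at hm
  simp only [l2_smul, mul_pow, sq_abs, ← hb, ← hc] at hp hm
  rw [abs_le] at hp hm ⊢
  have hbc : 0 < c * b := by positivity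
  constructor <;> refine le_of_mul_le_mul_left ?_ hbc <;> nlinarith

lemma l2_mulVec_le (h : RIC Φ r ≤ δ) {x : Fin N → ℂ} (hx : Sparse r x) {K : ℝ} (hK : 0 ≤ K)
    (hδ : 1 + δ ≤ K ^ 2) : l2 (Φ.mulVec x) ≤ K * l2 x := by
  have := (abs_le.1 (abs_l2_mulVec_sq_sub_le_of_RIC_le h hx)).2
  refine le_of_sq_le_sq ?_ (mul_nonneg hK (l2_nonneg x))
  nlinarith [mul_le_mul_of_nonneg_right hδ (sq_nonneg (l2 x))]

end RestrictedIsometry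

/-- **Identification.**  Let `x` and `a` be `s`-sparse, `r = x − a`, `v = Φr + e`,
`y = Φ*v`, and let `Ω = supp(y_{2s})` be a set of `2s` coordinates carrying the `2s`
largest magnitudes of `y`.  Then `‖r|_{Ω^c}‖₂ ≤ 0.2223‖r‖₂ + 2.34‖e‖₂`. -/
theorem identification
    {m N : ℕ} (s : ℕ) (hs : 0 < s) (Φ : Matrix (Fin m) (Fin N) ℂ)
    (h24 : RIC Φ (2 * s) ≤ RIC Φ (4 * s)) (hΦ : RIC Φ (4 * s) ≤ 0.1)
    (x a : Fin N → ℂ) (hx : Sparse s x) (ha : Sparse s a)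
    (e : Fin m → ℂ) (y2s : Fin N → ℂ)
    (hy : IsSparseApprox (2 * s) (Φᴴ.mulVec (Φ.mulVec (x - a) + e)) y2s)
    (Ω : Finset (Fin N)) (hΩ : Ω = suppF y2s) :
    l2 (restrictTo (x - a) Ωᶜ) ≤ 0.2223 * l2 (x - a) + 2.34 * l2 e := by
  obtain ⟨T, hTcard, rfl, hT⟩ := hy
  set r := x - a with hr
  set y := Φᴴ.mulVec (Φ.mulVec r + e) with hydef
  set R := suppF r with hR
  have hRcard : R.card ≤ 2 * s := by
    refine (Finset.card_le_card (t := suppF x ∪ suppF a) fun i hi => ?_).trans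
      ((Finset.card_union_le _ _).trans ?_)
    · by_contra hc
      rw [Finset.mem_union, not_or] at hc
      simp [hR, suppF, hr, eq_zero_of_notMem_suppF hc.1, eq_zero_of_notMem_suppF hc.2] at hi
    · unfold Sparse at hx ha
      omega
  have hRT : R.card ≤ T.card := by
    rw [hTcard]
    exact le_min hRcard (by simpa using Finset.card_le_univ R)
  have hr0 : ∀ i ∉ R, r i = 0 := fun i hi => eq_zero_of_notMem_suppF hi
  have hΩT : ∀ i ∈ T, i ∉ Ω → y i = 0 := by
    intro i hi hiΩ
    have h0 := eq_zero_of_notMem_suppF (hΩ ▸ hiΩ)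
    simpa [restrictTo, hi] using h0
  set A := R \ Ω with hA
  set B := T \ R with hB
  have hrA : restrictTo r Ωᶜ = restrictTo r A := by
    funext i
    by_cases h1 : i ∈ Ω <;> by_cases h2 : i ∈ R <;> simp [restrictTo, hA, h1, h2, hr0]
  have hunion : (R ∪ B).card ≤ 4 * s := by
    have h1 := Finset.card_union_le R B
    have h2 : B.card ≤ T.card := Finset.card_le_card Finset.sdiff_subset
    have h3 := min_le_left (2 * s) N
    omega
  have hrS : ∀ i ∉ R ∪ B, r i = 0 := fun i hi =>
    hr0 i fun hc => hi (Finset.mem_union_left _ hc)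
  have hASupp : ∀ i ∉ R ∪ B, restrictTo r A i = 0 := fun i hi =>
    restrictTo_of_notMem _ fun hc => hi (Finset.mem_union_left _ (Finset.mem_sdiff.1 hc).1)
  have hBSupp : ∀ i ∉ R ∪ B, restrictTo y B i = 0 := fun i hi =>
    restrictTo_of_notMem _ fun hc => hi (Finset.mem_union_right _ hc)
  have hyAB : l2 (restrictTo y A) ≤ l2 (restrictTo y B) := by
    refine le_of_sq_le_sq ?_ (l2_nonneg _)
    rw [l2_restrictTo_sq, l2_restrictTo_sq]
    calc ∑ i ∈ A, ‖y i‖ ^ 2 ≤ ∑ i ∈ R \ T, ‖y i‖ ^ 2 := by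
          rw [← Finset.sum_filter_ne_zero]
          refine Finset.sum_le_sum_of_subset_of_nonneg (fun i hi => ?_) fun i _ _ => sq_nonneg _
          obtain ⟨hiA, hne⟩ := Finset.mem_filter.1 hi
          obtain ⟨hiR, hiΩ⟩ := Finset.mem_sdiff.1 hiA
          refine Finset.mem_sdiff.2 ⟨hiR, fun hiT => hne ?_⟩
          simp [hΩT i hiT hiΩ]
      _ ≤ ∑ i ∈ B, ‖y i‖ ^ 2 := by
          refine sum_le_sum_of_card_le_of_le (fun i => sq_nonneg _) ?_ fun i hi j hj => ?_
          · have h1 := Finset.card_sdiff_add_card_inter R T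
            have h2 := Finset.card_sdiff_add_card_inter T R
            rw [Finset.inter_comm, ← hB] at h2
            omega
          · exact pow_le_pow_left₀ (norm_nonneg _)
              (hT j (Finset.mem_sdiff.1 hj).1 i (Finset.mem_sdiff.1 hi).2) 2
  have key : ∀ u : Fin N → ℂ, (∀ i ∉ R ∪ B, u i = 0) →
      |reInner u y - reInner u r| ≤ l2 u * (0.1 * l2 r + 1.05 * l2 e) := by
    intro u hu
    have h1 := reInner_mulVec_sub_le hΦ hunion hu hrS
    have h2 := abs_reInner_le (Φ.mulVec u) e
    have h3 := l2_mulVec_le hΦ (sparse_of_subset hunion hu) (K := 1.05) (by norm_num)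
      (by norm_num)
    have h4 := mul_le_mul_of_nonneg_right h3 (l2_nonneg e)
    rw [hydef, reInner_conjTranspose_mulVec, reInner_add_right]
    rw [abs_le] at h1 h2 ⊢
    constructor <;> linarith [h1.1, h1.2, h2.1, h2.2]
  have hyB : l2 (restrictTo y B) ≤ 0.1 * l2 r + 1.05 * l2 e := by
    have h1 := (abs_le.1 (key _ hBSupp)).2
    have h2 : reInner (restrictTo y B) r = 0 := by
      rw [← reInner_restrictTo_restrictTo]
      have : restrictTo r B = 0 := by
        funext i
        by_cases hi : i ∈ R <;> simp [restrictTo, hB, hi, hr0]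
      simp [this, reInner]
    rw [← reInner_restrictTo_restrictTo, reInner_self, h2, sub_zero, sq] at h1
    rcases (l2_nonneg (restrictTo y B)).eq_or_lt with h0 | h0
    · rw [← h0]
      linarith [l2_nonneg r, l2_nonneg e]
    · exact le_of_mul_le_mul_left h1 h0
  have hrAle : l2 (restrictTo r A) ≤ l2 (restrictTo y A) + (0.1 * l2 r + 1.05 * l2 e) := by
    have h1 := (abs_le.1 (key _ hASupp)).1
    have h2 := (abs_le.1 (abs_reInner_le (restrictTo r A) (restrictTo y A))).2
    rw [← reInner_restrictTo_restrictTo, ← reInner_restrictTo_restrictTo _ r, reInner_self] at h1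
    rcases (l2_nonneg (restrictTo r A)).eq_or_lt with h0 | h0
    · rw [← h0]
      linarith [l2_nonneg r, l2_nonneg e, l2_nonneg (restrictTo y A)]
    · refine le_of_mul_le_mul_left ?_ h0
      nlinarith
  rw [hrA]
  linarith [l2_nonneg r, l2_nonneg e]
end

section
/- Let Φ be an m×N complex matrix with δ_{3s}(Φ) ≤ δ_{4s}(Φ) ≤ 0.1. Let x ∈ ℂ^N be s-sparse, let e ∈ ℂ^m, and let u = Φx + e. Let a ∈ ℂ^N be an s-sparse approximation and let T be a set of at most 3s indices with supp(a) ⊆ T. Then ‖a − Φ_T†u‖₂ ≤ 2.112·‖x − a‖₂ + 1.06·‖e‖₂ (where a is identified with its restriction to the coordinates T). -/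
open Matrix
open scoped BigOperators Classical

lemma l2_eq_norm {ι : Type*} [Fintype ι] (x : ι → ℂ) : l2 x = ‖WithLp.toLp 2 x‖ := by
  simp [l2, EuclideanSpace.norm_eq]

lemma l2_nonneg_s14 {ι : Type*} [Fintype ι] (x : ι → ℂ) : 0 ≤ l2 x := Real.sqrt_nonneg _

lemma l2_add_le {ι : Type*} [Fintype ι] (x y : ι → ℂ) : l2 (x + y) ≤ l2 x + l2 y := by
  simpa only [l2_eq_norm, WithLp.toLp_add] using norm_add_le _ _

lemma l2_neg {ι : Type*} [Fintype ι] (x : ι → ℂ) : l2 (-x) = l2 x := by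
  simp [l2]

lemma l2_zero {ι : Type*} [Fintype ι] : l2 (0 : ι → ℂ) = 0 := by
  simp [l2]

lemma eq_zero_of_l2_eq_zero {ι : Type*} [Fintype ι] {x : ι → ℂ} (h : l2 x = 0) : x = 0 := by
  rw [l2_eq_norm, norm_eq_zero] at h
  simpa using h

/-- A vector orthogonal to its difference from `v` is no longer than `v`. -/
lemma l2_le_of_star_dotProduct_sub_eq_zero {ι : Type*} [Fintype ι] {p v : ι → ℂ}
    (h : star p ⬝ᵥ (v - p) = 0) : l2 p ≤ l2 v := by
  have hpv : inner ℂ (WithLp.toLp 2 p) (WithLp.toLp 2 p)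
      = inner ℂ (WithLp.toLp 2 p) (WithLp.toLp 2 v) := by
    rw [dotProduct_sub, sub_eq_zero] at h
    rw [EuclideanSpace.inner_toLp_toLp, EuclideanSpace.inner_toLp_toLp,
      dotProduct_comm, dotProduct_comm v, h]
  have hsq : ‖WithLp.toLp 2 p‖ * ‖WithLp.toLp 2 p‖ ≤ ‖WithLp.toLp 2 p‖ * ‖WithLp.toLp 2 v‖ := by
    have := norm_inner_le_norm (𝕜 := ℂ) (WithLp.toLp 2 p) (WithLp.toLp 2 v)
    rwa [← hpv, ← inner_self_re_eq_norm, inner_self_eq_norm_mul_norm] at this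
  rw [l2_eq_norm, l2_eq_norm]
  rcases (norm_nonneg (WithLp.toLp 2 p)).eq_or_lt with h0 | h0
  · rw [← h0]
    exact norm_nonneg _
  · exact le_of_mul_le_mul_left hsq h0

open scoped Matrix.Norms.L2Operator in
lemma exists_l2_mulVec_sq_le {m N : ℕ} (Φ : Matrix (Fin m) (Fin N) ℂ) :
    ∃ C : ℝ, ∀ x, l2 (Φ.mulVec x) ^ 2 ≤ C * l2 x ^ 2 := by
  refine ⟨‖Φ‖ ^ 2, fun x => ?_⟩
  rw [← mul_pow, l2_eq_norm, l2_eq_norm]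
  exact pow_le_pow_left₀ (norm_nonneg _) (Matrix.l2_opNorm_mulVec Φ (WithLp.toLp 2 x)) 2

/-- Any number above the restricted isometry constant is a valid isometry bound. -/
lemma restricted_isometry_of_RIC_lt {m N r : ℕ} {Φ : Matrix (Fin m) (Fin N) ℂ} {ε : ℝ}
    (h : RIC Φ r < ε) {x : Fin N → ℂ} (hx : Sparse r x) :
    (1 - ε) * l2 x ^ 2 ≤ l2 (Φ.mulVec x) ^ 2 ∧
      l2 (Φ.mulVec x) ^ 2 ≤ (1 + ε) * l2 x ^ 2 := by
  obtain ⟨C, hC⟩ := exists_l2_mulVec_sq_le Φ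
  have hne : {δ : ℝ | 0 ≤ δ ∧ ∀ x : Fin N → ℂ, Sparse r x →
      (1 - δ) * l2 x ^ 2 ≤ l2 (Φ.mulVec x) ^ 2 ∧
        l2 (Φ.mulVec x) ^ 2 ≤ (1 + δ) * l2 x ^ 2}.Nonempty := by
    refine ⟨max 1 C, le_max_of_le_left zero_le_one, fun y _ => ?_⟩
    have hy := sq_nonneg (l2 y)
    constructor
    · nlinarith [le_max_left 1 C, sq_nonneg (l2 (Φ.mulVec y))]
    · nlinarith [le_max_right 1 C, hC y]
  obtain ⟨δ, ⟨-, hδ⟩, hlt⟩ := exists_lt_of_csInf_lt hne h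
  obtain ⟨h1, h2⟩ := hδ x hx
  constructor <;> nlinarith [sq_nonneg (l2 x)]

lemma Sparse.of_support_subset {N r : ℕ} {x : Fin N → ℂ} {T : Finset (Fin N)}
    (h : ∀ i ∉ T, x i = 0) (hT : T.card ≤ r) : Sparse r x := by
  refine (Finset.card_le_card fun i hi => ?_).trans hT
  by_contra hiT
  exact (Finset.mem_filter.mp hi).2 (h i hiT)

lemma eq_zero_of_notMem_of_suppF_subset {N : ℕ} {x : Fin N → ℂ} {T : Finset (Fin N)}
    (h : suppF x ⊆ T) : ∀ i ∉ T, x i = 0 := fun i hi => by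
  by_contra hx
  exact hi (h (Finset.mem_filter.mpr ⟨Finset.mem_univ i, hx⟩))

lemma colSub_mulVec_restrict {m N : ℕ} (Φ : Matrix (Fin m) (Fin N) ℂ) {T : Finset (Fin N)}
    {x : Fin N → ℂ} (h : ∀ i ∉ T, x i = 0) :
    (colSub Φ T).mulVec (fun i => x i) = Φ.mulVec x := by
  ext r
  simp only [Matrix.mulVec, dotProduct, colSub, Matrix.of_apply]
  rw [Finset.sum_coe_sort T (fun i => Φ r i * x i)]
  refine Finset.sum_subset (Finset.subset_univ T) fun i _ hi => ?_
  rw [h i hi, mul_zero]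

lemma pinvApply_of_notMem {m N : ℕ} (Φ : Matrix (Fin m) (Fin N) ℂ) {T : Finset (Fin N)}
    (u : Fin m → ℂ) : ∀ i ∉ T, pinvApply Φ T u i = 0 := fun _ hi => dif_neg hi

open scoped ComplexOrder in
/-- The normal equations: when `Φ` is injective on vectors supported on `T`, the least-squares
residual is orthogonal to the range of `Φ_T`. -/
lemma colSub_conjTranspose_mulVec_residual {m N : ℕ} {Φ : Matrix (Fin m) (Fin N) ℂ}
    {T : Finset (Fin N)} (hΦ : ∀ x : Fin N → ℂ, (∀ i ∉ T, x i = 0) → Φ.mulVec x = 0 → x = 0)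
    (u : Fin m → ℂ) :
    (colSub Φ T)ᴴ.mulVec (u - Φ.mulVec (pinvApply Φ T u)) = 0 := by
  have hunit : IsUnit ((colSub Φ T)ᴴ * colSub Φ T) := by
    rw [← Matrix.mulVec_injective_iff_isUnit, ← Matrix.coe_mulVecLin,
      injective_iff_map_eq_zero]
    intro z hz
    have hz' : (colSub Φ T).mulVec z = 0 :=
      (Matrix.conjTranspose_mul_self_mulVec_eq_zero _ _).mp hz
    let x : Fin N → ℂ := fun i => if h : i ∈ T then z ⟨i, h⟩ else 0
    have hx : ∀ i ∉ T, x i = 0 := fun i hi => dif_neg hi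
    have hxz : (fun i : {i // i ∈ T} => x i) = z := by
      ext i
      simp [x]
    have hx0 := hΦ x hx (by rw [← colSub_mulVec_restrict Φ hx, hxz, hz'])
    rw [← hxz, hx0]
    rfl
  have hb : (fun i : {i // i ∈ T} => pinvApply Φ T u i)
      = (((colSub Φ T)ᴴ * colSub Φ T)⁻¹ * (colSub Φ T)ᴴ).mulVec u := by
    ext i
    simp [pinvApply]
  rw [← colSub_mulVec_restrict Φ (pinvApply_of_notMem Φ u), hb, Matrix.mulVec_sub,
    Matrix.mulVec_mulVec, Matrix.mulVec_mulVec, ← Matrix.mul_assoc,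
    Matrix.mul_nonsing_inv _ ((Matrix.isUnit_iff_isUnit_det _).mp hunit), Matrix.one_mul,
    sub_self]

/-- **Initial iterate for least squares.**  Let `x` be `s`-sparse with noisy samples
`u = Φx + e`, let `a` be an `s`-sparse approximation, and let `T ⊇ supp(a)` have at most
`3s` indices.  Then `‖a − Φ_T†u‖₂ ≤ 2.112‖x − a‖₂ + 1.06‖e‖₂`. -/
theorem ls_initial_iterate
    {m N : ℕ} (s : ℕ) (Φ : Matrix (Fin m) (Fin N) ℂ)
    (h34 : RIC Φ (3 * s) ≤ RIC Φ (4 * s)) (hΦ : RIC Φ (4 * s) ≤ 0.1)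
    (x : Fin N → ℂ) (hx : Sparse s x) (e : Fin m → ℂ)
    (u : Fin m → ℂ) (hu : u = Φ.mulVec x + e)
    (a : Fin N → ℂ) (ha : Sparse s a)
    (T : Finset (Fin N)) (hT : T.card ≤ 3 * s) (haT : suppF a ⊆ T) :
    l2 (a - pinvApply Φ T u) ≤ 2.112 * l2 (x - a) + 1.06 * l2 e := by
  have rip : ∀ {y : Fin N → ℂ}, Sparse (4 * s) y →
      (1 - 0.101) * l2 y ^ 2 ≤ l2 (Φ.mulVec y) ^ 2 ∧
        l2 (Φ.mulVec y) ^ 2 ≤ (1 + 0.101) * l2 y ^ 2 :=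
    restricted_isometry_of_RIC_lt (lt_of_le_of_lt hΦ (by norm_num))
  have ha0 := eq_zero_of_notMem_of_suppF_subset haT
  have hx0 := eq_zero_of_notMem_of_suppF_subset (subset_refl (suppF x))
  have hinj : ∀ y : Fin N → ℂ, (∀ i ∉ T, y i = 0) → Φ.mulVec y = 0 → y = 0 := by
    intro y hy hΦy
    have h := (rip (Sparse.of_support_subset hy (by omega))).1
    rw [hΦy, l2_zero] at h
    exact eq_zero_of_l2_eq_zero (pow_eq_zero_iff two_ne_zero |>.mp
      (le_antisymm (by linarith) (sq_nonneg _)))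
  set w := pinvApply Φ T u - a with hw
  have hwT : ∀ i ∉ T, w i = 0 := fun i hi => by
    simp [hw, pinvApply_of_notMem Φ u i hi, ha0 i hi]
  have hres : u - Φ.mulVec (pinvApply Φ T u) = (Φ.mulVec (x - a) + e) - Φ.mulVec w := by
    rw [hw, hu, Matrix.mulVec_sub, Matrix.mulVec_sub]
    abel
  have hproj : l2 (Φ.mulVec w) ≤ l2 (Φ.mulVec (x - a) + e) := by
    apply l2_le_of_star_dotProduct_sub_eq_zero
    rw [← hres, ← colSub_mulVec_restrict Φ hwT, Matrix.star_mulVec, ← Matrix.dotProduct_mulVec,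
      colSub_conjTranspose_mulVec_residual hinj, dotProduct_zero]
  have hlow := (rip (Sparse.of_support_subset hwT (by omega))).1
  have hup := (rip (y := x - a) (Sparse.of_support_subset (T := T ∪ suppF x)
    (fun i hi => by
      rw [Finset.mem_union, not_or] at hi
      simp [ha0 i hi.1, hx0 i hi.2])
    ((Finset.card_union_le _ _).trans (by
      unfold Sparse at hx
      omega)))).2
  have hΦw : l2 (Φ.mulVec w) ≤ l2 (Φ.mulVec (x - a)) + l2 e := hproj.trans (l2_add_le _ _)
  have h1 : l2 (Φ.mulVec (x - a)) ≤ 1.05 * l2 (x - a) :=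
    abs_le_of_sq_le_sq' (by nlinarith [sq_nonneg (l2 (x - a))])
      (by linarith [l2_nonneg_s14 (x - a)]) |>.2
  have h2 : l2 w ≤ 1.06 * l2 (Φ.mulVec w) :=
    abs_le_of_sq_le_sq' (by nlinarith [sq_nonneg (l2 w)])
      (by linarith [l2_nonneg_s14 (Φ.mulVec w)]) |>.2
  rw [← neg_sub, l2_neg]
  linarith [l2_nonneg_s14 (x - a)]
end
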